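/- (Itakura–Saito majorization.) Let v ∈ ℝ^N with v_n > 0 for all n, H ∈ ℝ_+^{K×N}, and let w̃ ∈ ℝ^K have strictly positive entries with ṽ = w̃H satisfying ṽ_n > 0 for all n. Define, for w ∈ ℝ^K with strictly positive entries, G(w | w̃) = Σ_n [ (v_n/ṽ_n²)·Σ_k h_{kn} w̃_k²/w_k + (1/ṽ_n)·Σ_k (w_k − w̃_k) h_{kn} + log ṽ_n − log v_n − 1 ], obtained by majorizing the convex part x ↦ v_n/x of the IS divergence via Jensen's inequality and the concave part x ↦ log x by its tangent at ṽ_n. Then G(w | w̃) ≥ Σ_n d_IS(v_n | (wH)_n) for all such w, with equality when w = w̃. -/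

import Mathlib

/-- The Itakura–Saito divergence between positive scalars. -/
noncomputable def dIS (x y : ℝ) : ℝ := x / y - Real.log (x / y) - 1

/-- Itakura–Saito majorization: with `v > 0`, `H ≥ 0`, `w̃ > 0` and `ṽ = w̃H > 0`,
the function
`G(w|w̃) = Σ_n [ (v_n/ṽ_n²) Σ_k h_{kn} w̃_k²/w_k + (1/ṽ_n) Σ_k (w_k − w̃_k) h_{kn}
  + log ṽ_n − log v_n − 1 ]`
satisfies `G(w|w̃) ≥ Σ_n d_IS(v_n | (wH)_n)` for all `w > 0`, with equality at `w = w̃`. -/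
theorem IS_auxiliary {K N : ℕ}
    (v : Fin N → ℝ) (hv : ∀ n, 0 < v n)
    (H : Matrix (Fin K) (Fin N) ℝ) (hH : ∀ k n, 0 ≤ H k n)
    (wt : Fin K → ℝ) (hwt : ∀ k, 0 < wt k)
    (vt : Fin N → ℝ) (hvt : ∀ n, vt n = ∑ k, wt k * H k n)
    (hvtpos : ∀ n, 0 < vt n)
    (G : (Fin K → ℝ) → ℝ)
    (hG : ∀ w, G w = ∑ n,
      (((v n / (vt n) ^ 2) * ∑ k, H k n * (wt k) ^ 2 / w k)
        + ((1 / vt n) * ∑ k, (w k - wt k) * H k n)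
        + Real.log (vt n) - Real.log (v n) - 1)) :
    (∀ w : Fin K → ℝ, (∀ k, 0 < w k) →
      (∑ n, dIS (v n) (∑ k, w k * H k n)) ≤ G w) ∧
    G wt = ∑ n, dIS (v n) (∑ k, wt k * H k n) := by
  constructor
  · intro w hw
    rw [hG]
    refine Finset.sum_le_sum fun n _ => ?_
    have hx : 0 < ∑ k, w k * H k n := by
      have hp := hvtpos n
      rw [hvt] at hp
      obtain ⟨k, -, hk⟩ := Finset.exists_lt_of_sum_lt
        (s := Finset.univ) (f := fun _ : Fin K => (0 : ℝ)) (g := fun k => wt k * H k n)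
        (by simpa using hp)
      have hk' : 0 < H k n := (pos_iff_pos_of_mul_pos hk).1 (hwt k)
      exact Finset.sum_pos' (fun i _ => mul_nonneg (hw i).le (hH i n))
        ⟨k, Finset.mem_univ _, mul_pos (hw k) hk'⟩
    have hcs : (∑ k, wt k * H k n) ^ 2 ≤
        (∑ k, H k n * (wt k) ^ 2 / w k) * ∑ k, w k * H k n := by
      refine Finset.sum_sq_le_sum_mul_sum_of_sq_eq_mul _ ?_ ?_ ?_
      · intro k _
        exact div_nonneg (mul_nonneg (hH k n) (sq_nonneg _)) (hw k).le
      · intro k _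
        exact mul_nonneg (hw k).le (hH k n)
      · intro k _
        have := (hw k).ne'
        field_simp
    rw [← hvt] at hcs
    have hd : ∑ k, (w k - wt k) * H k n = (∑ k, w k * H k n) - vt n := by
      rw [hvt, ← Finset.sum_sub_distrib]
      exact Finset.sum_congr rfl fun k _ => by ring
    rw [hd]
    generalize (∑ k, w k * H k n) = x at *
    generalize (∑ k, H k n * (wt k) ^ 2 / w k) = S at *
    have ht := hvtpos n
    have hvn := hv n
    have h1 : v n / x ≤ v n / (vt n) ^ 2 * S := by
      rw [div_mul_eq_mul_div, div_le_div_iff₀ hx (by positivity)]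
      nlinarith [mul_le_mul_of_nonneg_left hcs hvn.le]
    have h2 : Real.log (x / vt n) ≤ x / vt n - 1 :=
      Real.log_le_sub_one_of_pos (by positivity)
    rw [Real.log_div hx.ne' ht.ne'] at h2
    have h3 : 1 / vt n * (x - vt n) = x / vt n - 1 := by
      field_simp
    rw [dIS, Real.log_div hvn.ne' hx.ne', h3]
    linarith
  · rw [hG]
    refine Finset.sum_congr rfl fun n _ => ?_
    have ht := hvtpos n
    have hS : ∑ k, H k n * (wt k) ^ 2 / wt k = vt n := by
      rw [hvt]
      refine Finset.sum_congr rfl fun k _ => ?_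
      have := (hwt k).ne'
      field_simp
    rw [hS, ← hvt, dIS, Real.log_div (hv n).ne' ht.ne']
    have h4 : v n / (vt n) ^ 2 * vt n = v n / vt n := by
      field_simp
    rw [h4]
    simp
    ring
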